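/- Let D be a pseudo-distribution on {0,1}^n of degree at least 2t, let S ⊆ [n], and suppose Ẽ_D[X_T · x_i] = 0 for every T ⊆ S with |T| ≥ t and every i ∈ [n]. Then for every U ⊆ S and every i ∈ [n], Ẽ_D[rd(f_{S,U})² · x_i] = Ẽ_D[rd(f_{S,U}) · x_i]. -/

import Mathlib

/-- The point of `{0,1}` encoded by a boolean. -/
def b01 (b : Bool) : ℝ := if b then 1 else 0

/-- Pseudo-expectation of `f` with respect to `D` on `{0,1}^n`. -/
def PE {n : ℕ} (D f : (Fin n → Bool) → ℝ) : ℝ := ∑ x, D x * f x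

/-- The monomial `X_T(x) = ∏_{i ∈ T} x_i` on `{0,1}^n`. -/
def XS {n : ℕ} (T : Finset (Fin n)) (x : Fin n → Bool) : ℝ := ∏ i ∈ T, b01 (x i)

/-- `f : {0,1}^n → ℝ` is a (multilinear) polynomial of degree at most `d`. -/
def DegLE {n : ℕ} (d : ℕ) (f : (Fin n → Bool) → ℝ) : Prop :=
  ∃ c : Finset (Fin n) → ℝ, (∀ T : Finset (Fin n), d < T.card → c T = 0) ∧
    ∀ x, f x = ∑ T : Finset (Fin n), c T * XS T x

/-- `f_{S,U}` viewed as a function on `{0,1}^n`: the indicator that the set of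
1-coordinates of `x` inside `S` is exactly `U`. -/
def indF {n : ℕ} (S U : Finset (Fin n)) (x : Fin n → Bool) : ℝ :=
  if S.filter (fun i => x i = true) = U then 1 else 0

/-- `rd`: the truncation of the multilinear polynomial with coefficients `c`
to monomials of degree strictly less than `t`. -/
def rd {n : ℕ} (t : ℕ) (c : Finset (Fin n) → ℝ) (x : Fin n → Bool) : ℝ :=
  ∑ T ∈ Finset.univ.filter (fun T : Finset (Fin n) => T.card < t), c T * XS T x

theorem XS_mul_XS {n : ℕ} (T T' : Finset (Fin n)) (x : Fin n → Bool) :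
    XS T x * XS T' x = XS (T ∪ T') x := by
  have h (A : Finset (Fin n)) : XS A x = if ∀ i ∈ A, x i = true then 1 else 0 := by
    simp only [XS, b01, Finset.prod_boole]
    congr
  simp only [h, Finset.mem_union, or_imp, forall_and]
  split_ifs <;> simp_all

theorem XS_indicator {n : ℕ} (T A : Finset (Fin n)) :
    XS T (fun i => decide (i ∈ A)) = if T ⊆ A then 1 else 0 := by
  simp only [XS, b01, Finset.prod_boole, decide_eq_true_eq, Finset.subset_iff]
  congr

theorem sum_subset_eq_indF {n : ℕ} {S U : Finset (Fin n)} {c : Finset (Fin n) → ℝ}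
    (hc : ∀ x, indF S U x = ∑ T, c T * XS T x) (A : Finset (Fin n)) :
    ∑ T ∈ A.powerset, c T = if S ∩ A = U then 1 else 0 := by
  have h := hc (fun i => decide (i ∈ A))
  simp only [XS_indicator, indF, decide_eq_true_eq, Finset.filter_mem_eq_inter, mul_ite, mul_one,
    mul_zero, ← Finset.sum_filter] at h
  rw [h]
  exact Finset.sum_congr (by ext; simp) fun _ _ => rfl

/-- The multilinear expansion of `f_{S,U}` only involves monomials `X_T` with `T ⊆ S`. -/
theorem coeff_indF_eq_zero {n : ℕ} {S U : Finset (Fin n)} {c : Finset (Fin n) → ℝ}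
    (hc : ∀ x, indF S U x = ∑ T, c T * XS T x) (T : Finset (Fin n)) (hT : ¬ T ⊆ S) :
    c T = 0 := by
  induction T using Finset.strongInduction with
  | H T ih =>
    have hcap : ∑ A ∈ T.powerset, c A = ∑ A ∈ (S ∩ T).powerset, c A := by
      rw [sum_subset_eq_indF hc, sum_subset_eq_indF hc]
      simp
    have hmem : T ∉ (S ∩ T).powerset := by
      simp only [Finset.mem_powerset, Finset.subset_inter_iff]
      exact fun h => hT h.1
    have hins : ∑ A ∈ insert T (S ∩ T).powerset, c A = ∑ A ∈ T.powerset, c A := by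
      refine Finset.sum_subset ?_ fun A hA hA' => ?_
      · intro A hA
        rcases Finset.mem_insert.mp hA with rfl | hA
        · simp
        · exact Finset.powerset_mono.mpr Finset.inter_subset_right hA
      · rw [Finset.mem_powerset] at hA
        simp only [Finset.mem_insert, Finset.mem_powerset, Finset.subset_inter_iff, not_or,
          not_and] at hA'
        exact ih A (hA.ssubset_of_ne hA'.1) fun h => hA'.2 h hA
    rw [Finset.sum_insert hmem] at hins
    linarith

theorem indF_mul_self {n : ℕ} (S U : Finset (Fin n)) (x : Fin n → Bool) :
    indF S U x * indF S U x = indF S U x := by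
  simp [indF]

theorem PE_sum {n : ℕ} {ι : Type*} (s : Finset ι) (D : (Fin n → Bool) → ℝ)
    (f : ι → (Fin n → Bool) → ℝ) :
    PE D (fun x => ∑ j ∈ s, f j x) = ∑ j ∈ s, PE D (f j) := by
  simp only [PE, Finset.mul_sum]
  exact Finset.sum_comm

theorem PE_const_mul {n : ℕ} (D f : (Fin n → Bool) → ℝ) (a : ℝ) :
    PE D (fun x => a * f x) = a * PE D f := by
  simp only [PE, Finset.mul_sum, mul_left_comm]

theorem PE_sub {n : ℕ} (D f g : (Fin n → Bool) → ℝ) :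
    PE D (fun x => f x - g x) = PE D f - PE D g := by
  simp only [PE, mul_sub, Finset.sum_sub_distrib]

/-- If `Ẽ_D[X_T · w] = 0` for all `T ⊆ S` with `|T| ≥ t`, then `Ẽ_D[p · q · w] = 0` for all
polynomials `p`, `q` in the variables of `S` such that `p` has only monomials of degree at
least `t`. -/
theorem PE_mul_eq_zero {n t : ℕ} {D w : (Fin n → Bool) → ℝ} {S : Finset (Fin n)}
    (hw : ∀ T ⊆ S, t ≤ T.card → PE D (fun x => XS T x * w x) = 0)
    {a b : Finset (Fin n) → ℝ} (ha : ∀ T, ¬ T ⊆ S → a T = 0) (ha' : ∀ T, T.card < t → a T = 0)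
    (hb : ∀ T, ¬ T ⊆ S → b T = 0) :
    PE D (fun x => (∑ T, a T * XS T x) * (∑ T, b T * XS T x) * w x) = 0 := by
  have hexp (x : Fin n → Bool) : (∑ T, a T * XS T x) * (∑ T, b T * XS T x) * w x =
      ∑ T, ∑ T', a T * b T' * (XS (T ∪ T') x * w x) := by
    rw [Finset.sum_mul_sum, Finset.sum_mul]
    refine Finset.sum_congr rfl fun T _ => ?_
    rw [Finset.sum_mul]
    refine Finset.sum_congr rfl fun T' _ => ?_
    rw [← XS_mul_XS]
    ring
  simp only [hexp, PE_sum, PE_const_mul]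
  refine Finset.sum_eq_zero fun T _ => Finset.sum_eq_zero fun T' _ => ?_
  by_cases hT : T ⊆ S
  · by_cases hT' : T' ⊆ S
    · rcases lt_or_ge T.card t with h | h
      · simp [ha' T h]
      · rw [hw _ (Finset.union_subset hT hT')
          (h.trans (Finset.card_le_card Finset.subset_union_left)), mul_zero]
    · simp [hb T' hT']
  · simp [ha T hT]

/-- if `D` is a pseudo-distribution on `{0,1}^n` of degree at
least `2t`, `S ⊆ [n]`, and `Ẽ_D[X_T · x_i] = 0` for all `T ⊆ S` with `|T| ≥ t`
and all `i`, then for every `U ⊆ S` and every `i`,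
`Ẽ_D[rd(f_{S,U})² · x_i] = Ẽ_D[rd(f_{S,U}) · x_i]`. -/
theorem rd_square_eq_rd (n t : ℕ) (D : (Fin n → Bool) → ℝ) (hsum : ∑ x, D x = 1)
    (hdeg : ∀ f : (Fin n → Bool) → ℝ, DegLE t f → 0 ≤ PE D (fun x => f x * f x))
    (S : Finset (Fin n))
    (hvanish : ∀ T : Finset (Fin n), T ⊆ S → t ≤ T.card → ∀ i : Fin n,
      PE D (fun x => XS T x * b01 (x i)) = 0)
    (coeff : Finset (Fin n) → Finset (Fin n) → ℝ)
    (hcoeff : ∀ (U : Finset (Fin n)) (x : Fin n → Bool),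
      indF S U x = ∑ T : Finset (Fin n), coeff U T * XS T x) :
    ∀ U : Finset (Fin n), U ⊆ S → ∀ i : Fin n,
      PE D (fun x => rd t (coeff U) x * rd t (coeff U) x * b01 (x i)) =
        PE D (fun x => rd t (coeff U) x * b01 (x i)) := by
  intro U _ i
  have hzero := coeff_indF_eq_zero (hcoeff U)
  rw [← sub_eq_zero, ← PE_sub]
  rw [← PE_mul_eq_zero (t := t) (S := S) (w := fun x => b01 (x i))
    (a := fun T => if T.card < t then 0 else coeff U T)
    (b := fun T => (if T = ∅ then 1 else 0) - coeff U T - if T.card < t then coeff U T else 0)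
    (fun T hT ht => hvanish T hT ht i) (fun T hT => by simp [hzero T hT])
    (fun T hT => by simp [hT])
    (fun T hT => by
      have hne : T ≠ ∅ := by rintro rfl; exact hT (Finset.empty_subset S)
      simp [hzero T hT, hne])]
  congr 1
  funext x
  have hlow : ∑ T, (if T.card < t then coeff U T else 0) * XS T x = rd t (coeff U) x := by
    simp only [rd, Finset.sum_filter, ite_mul, zero_mul]
  have hhigh : ∑ T, (if T.card < t then 0 else coeff U T) * XS T x =
      indF S U x - rd t (coeff U) x := by
    rw [hcoeff, ← hlow, ← Finset.sum_sub_distrib]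
    refine Finset.sum_congr rfl fun T _ => ?_
    split_ifs <;> ring
  have hcofactor : ∑ T, ((if T = ∅ then 1 else 0) - coeff U T -
      if T.card < t then coeff U T else 0) * XS T x =
      1 - indF S U x - rd t (coeff U) x := by
    simp only [sub_mul, Finset.sum_sub_distrib, hlow, ← hcoeff]
    simp [XS]
  rw [hhigh, hcofactor]
  linear_combination b01 (x i) * indF_mul_self S U x
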